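/- arXiv:1704.02562 — 4 statements merged into one kernel-verified Lean document; each statement's English description precedes it below -/
import Mathlib

section
/- Let α be a countable index type, d : α → ℝ with d(a) ≥ 0 for all a, and c : α → ℝ. Assume: (i) for every ε > 0 the set {a : |c(a)| > ε·d(a)} is finite; (ii) there exists s ∈ ℝ such that a ↦ exp(−s·d(a)) is summable; (iii) there exists s ∈ ℝ such that a ↦ exp(−s·d(a)) is not summable. Then sInf {s ∈ ℝ : a ↦ exp(c(a) − s·d(a)) is summable} = sInf {s ∈ ℝ : a ↦ exp(−s·d(a)) is summable}. -/
/-- Changing the potential by at most `ε * d`, up to finitely many indices, costs at most `ε`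
in the exponent of summability. -/
theorem summable_exp_sub_add_mul {α : Type*} {c c' d : α → ℝ} {s ε : ℝ}
    (h : ∀ᶠ a in Filter.cofinite, c' a - c a ≤ ε * d a)
    (hs : Summable (fun a => Real.exp (c a - s * d a))) :
    Summable (fun a => Real.exp (c' a - (s + ε) * d a)) := by
  refine hs.of_norm_bounded_eventually ?_
  filter_upwards [h] with a ha
  rw [Real.norm_eq_abs, Real.abs_exp, Real.exp_le_exp]
  linarith

theorem csInf_le_csInf_of_forall_add_mem {A B : Set ℝ} (hA : A.Nonempty) (hB : BddBelow B)
    (h : ∀ ε : ℝ, 0 < ε → ∀ s ∈ A, s + ε ∈ B) : sInf B ≤ sInf A :=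
  le_csInf hA fun s hs => le_of_forall_pos_le_add fun ε hε => csInf_le hB (h ε hε s hs)

theorem stmt_1 {α : Type*} [Countable α] (d : α → ℝ) (hd : ∀ a, 0 ≤ d a)
    (c : α → ℝ)
    (hfin : ∀ ε : ℝ, 0 < ε → {a : α | ε * d a < |c a|}.Finite)
    (hconv : ∃ s : ℝ, Summable (fun a => Real.exp (-s * d a)))
    (hdiv : ∃ s : ℝ, ¬ Summable (fun a => Real.exp (-s * d a))) :
    sInf {s : ℝ | Summable (fun a => Real.exp (c a - s * d a))} =
      sInf {s : ℝ | Summable (fun a => Real.exp (-s * d a))} := by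
  have hzero (s : ℝ) : (fun a => Real.exp (-s * d a)) = fun a => Real.exp (0 - s * d a) := by
    simp
  simp only [hzero] at hconv hdiv ⊢
  have habs (ε : ℝ) (hε : 0 < ε) : ∀ᶠ a in Filter.cofinite, |c a| ≤ ε * d a := by
    simpa [Filter.eventually_cofinite] using hfin ε hε
  have hto (ε : ℝ) (hε : 0 < ε) (s : ℝ) (hs : Summable (fun a => Real.exp (0 - s * d a))) :
      Summable (fun a => Real.exp (c a - (s + ε) * d a)) :=
    summable_exp_sub_add_mul (c := fun _ => 0)
      ((habs ε hε).mono fun a ha => by linarith [le_abs_self (c a)]) hs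
  have hfrom (ε : ℝ) (hε : 0 < ε) (s : ℝ) (hs : Summable (fun a => Real.exp (c a - s * d a))) :
      Summable (fun a => Real.exp (0 - (s + ε) * d a)) :=
    summable_exp_sub_add_mul (c' := fun _ => 0)
      ((habs ε hε).mono fun a ha => by linarith [neg_le_abs (c a)]) hs
  obtain ⟨s₀, hs₀⟩ := hconv
  obtain ⟨s₁, hs₁⟩ := hdiv
  have hlower (s : ℝ) (hs : Summable (fun a => Real.exp (0 - s * d a))) : s₁ ≤ s := by
    by_contra! hlt
    refine hs₁ (hs.of_nonneg_of_le (fun a => (Real.exp_pos _).le) fun a => ?_)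
    exact Real.exp_le_exp.2 (sub_le_sub_left (mul_le_mul_of_nonneg_right hlt.le (hd a)) 0)
  exact le_antisymm
    (csInf_le_csInf_of_forall_add_mem ⟨s₀, hs₀⟩
      ⟨s₁ - 1, fun s hs => by linarith [hlower _ (hfrom 1 one_pos s hs)]⟩ hto)
    (csInf_le_csInf_of_forall_add_mem ⟨s₀ + 1, hto 1 one_pos s₀ hs₀⟩ ⟨s₁, hlower⟩ hfrom)
end

section
/- Let α be a countable index type, δ ≥ 0, and c, d : α → ℝ with c(a) ≥ 0 and d(a) ≥ 0 for all a. Suppose S : ℕ → Set α is a family of pairwise disjoint sets with ⋃_{n ≥ 1} S(n) = α, such that for every n ≥ 1: (i) the sum of exp(−(δ + 1/n)·d(a)) over all a in ⋃_{m ≥ n} S(m) is at most 1/n²; and (ii) c(a) ≥ d(a)/n for every a ∈ S(n). Then the family a ↦ exp(−c(a) − δ·d(a)) is summable and its sum is at most ∑_{n ≥ 1} 1/n² = π²/6. -/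
/-- A finite sum of a nonnegative function over points satisfying `p` is at most the total sum
over the subtype of `p`. -/
theorem sum_le_tsum_subtype_of_forall {α : Type*} {p : α → Prop} {g : α → ℝ}
    (hg : ∀ a, 0 ≤ g a) (hs : Summable fun a : {a // p a} => g a) (t : Finset α)
    (ht : ∀ a ∈ t, p a) : ∑ a ∈ t, g a ≤ ∑' a : {a // p a}, g a := by
  classical
  rw [← Finset.sum_subtype_of_mem g ht]
  exact hs.sum_le_tsum _ fun a _ => hg a

theorem stmt_2 {α : Type*} [Countable α] (δ : ℝ) (hδ : 0 ≤ δ)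
    (c d : α → ℝ) (hc : ∀ a, 0 ≤ c a) (hd : ∀ a, 0 ≤ d a)
    (S : ℕ → Set α)
    (hdisj : Pairwise (Function.onFun Disjoint S))
    (hcover : ∀ a : α, ∃ n : ℕ, 1 ≤ n ∧ a ∈ S n)
    (hsum : ∀ n : ℕ, 1 ≤ n →
      Summable (fun a : {a : α // ∃ m : ℕ, n ≤ m ∧ a ∈ S m} =>
        Real.exp (-(δ + 1 / n) * d a)) ∧
      ∑' a : {a : α // ∃ m : ℕ, n ≤ m ∧ a ∈ S m},
        Real.exp (-(δ + 1 / n) * d a) ≤ 1 / (n : ℝ) ^ 2)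
    (hgrow : ∀ n : ℕ, 1 ≤ n → ∀ a ∈ S n, d a / n ≤ c a) :
    Summable (fun a => Real.exp (-c a - δ * d a)) ∧
      ∑' a, Real.exp (-c a - δ * d a) ≤ Real.pi ^ 2 / 6 := by
  have hle : ∀ s : Finset α, ∑ a ∈ s, Real.exp (-c a - δ * d a) ≤ Real.pi ^ 2 / 6 := by
    classical
    choose N hN hNS using hcover
    intro s
    calc ∑ a ∈ s, Real.exp (-c a - δ * d a)
        = ∑ n ∈ s.image N, ∑ a ∈ s with N a = n, Real.exp (-c a - δ * d a) :=
          (Finset.sum_fiberwise_of_maps_to (fun a ha => Finset.mem_image_of_mem N ha) _).symm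
      _ ≤ ∑ n ∈ s.image N, 1 / (n : ℝ) ^ 2 := by
          refine Finset.sum_le_sum fun n hn => ?_
          obtain ⟨b, -, rfl⟩ := Finset.mem_image.1 hn
          obtain ⟨hs, hb⟩ := hsum (N b) (hN b)
          refine le_trans (Finset.sum_le_sum fun a ha => ?_)
            ((sum_le_tsum_subtype_of_forall (g := fun a => Real.exp (-(δ + 1 / N b) * d a))
              (fun a => (Real.exp_pos _).le) hs
              (s.filter fun a => N a = N b) fun a ha =>
                ⟨N a, (Finset.mem_filter.1 ha).2.ge, hNS a⟩).trans hb)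
          have h := hgrow (N a) (hN a) a (hNS a)
          rw [(Finset.mem_filter.1 ha).2] at h
          refine Real.exp_le_exp.2 ?_
          calc -c a - δ * d a ≤ -(d a / N b) - δ * d a := by linarith
            _ = -(δ + 1 / N b) * d a := by ring
      _ ≤ Real.pi ^ 2 / 6 := sum_le_hasSum _ (fun n _ => by positivity) hasSum_zeta_two
  exact ⟨summable_of_sum_le (fun a => (Real.exp_pos _).le) hle,
    Real.tsum_le_of_sum_le (fun a => (Real.exp_pos _).le) hle⟩
end

section
/- Let g₂ : ℝ → ℝ be differentiable at a point t > 0, with g₂ positive on a neighborhood of t. Define v : ℝ → ℝ by v(s) = 1/(s·√(g₂(s))). Then v is differentiable at t and (2·t·v(t) + t²·(deriv v)(t)) / (t·v(t))³ = g₂(t) − (t/2)·(deriv g₂)(t). -/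
theorem stmt_6 (g₂ : ℝ → ℝ) (t : ℝ) (ht : 0 < t)
    (hdiff : DifferentiableAt ℝ g₂ t)
    (hpos : ∀ᶠ s in nhds t, 0 < g₂ s) :
    DifferentiableAt ℝ (fun s => 1 / (s * Real.sqrt (g₂ s))) t ∧
    (2 * t * (1 / (t * Real.sqrt (g₂ t))) +
        t ^ 2 * deriv (fun s => 1 / (s * Real.sqrt (g₂ s))) t) /
      (t * (1 / (t * Real.sqrt (g₂ t)))) ^ 3 =
    g₂ t - (t / 2) * deriv g₂ t := by
  have hg : 0 < g₂ t := hpos.self_of_nhds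
  have hr : 0 < Real.sqrt (g₂ t) := Real.sqrt_pos.2 hg
  have hsq : Real.sqrt (g₂ t) ^ 2 = g₂ t := Real.sq_sqrt hg.le
  have hv : HasDerivAt (fun s => 1 / (s * Real.sqrt (g₂ s)))
      (-(Real.sqrt (g₂ t) + t * (deriv g₂ t / (2 * Real.sqrt (g₂ t)))) /
        (t * Real.sqrt (g₂ t)) ^ 2) t := by
    simpa [Pi.mul_def, Pi.inv_def] using
      ((hasDerivAt_id t).mul (hdiff.hasDerivAt.sqrt hg.ne')).inv (mul_pos ht hr).ne'
  refine ⟨hv.differentiableAt, ?_⟩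
  rw [hv.deriv]
  generalize Real.sqrt (g₂ t) = r at hr hsq
  rw [← hsq]
  field_simp
  ring
end

section
/- Let d : ℤ → ℝ, u : ℕ → ℝ, D ≥ 0, c : ℤ → ℝ, m ≥ 1, and let K : ℕ → ℕ be strictly increasing. Assume: (i) |d(j) − 2·u(|j|)| ≤ D for every nonzero integer j; (ii) for every n ≥ m and every nonzero j with K(n) ≤ |j| < K(n+1), c(j) ≤ −(1/n)·d(j); and (iii) for every n ≥ m, exp((1/2 + 1/n)·D) · ∑_{|j| ≥ K(n)} exp(−(1 + 2/n)·u(|j|)) ≤ 1/n². Then ∑_{|j| ≥ K(m)} exp(c(j) − (1/2)·d(j)) ≤ ∑_{n ≥ m} 1/n²; in particular this series converges. -/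
/-- A strictly increasing sequence of naturals cuts `[K m, ∞)` into the blocks
`[K n, K (n + 1))`, `n ≥ m`. -/
lemma StrictMono.exists_block {K : ℕ → ℕ} (hK : StrictMono K) {m a : ℕ} (ha : K m ≤ a) :
    ∃ n, m ≤ n ∧ K n ≤ a ∧ a < K (n + 1) := by
  have hma : m ≤ a := (hK.id_le m).trans ha
  refine ⟨Nat.findGreatest (fun n => K n ≤ a) a, Nat.le_findGreatest hma ha,
    Nat.findGreatest_spec (P := fun n => K n ≤ a) hma ha, ?_⟩
  by_contra! h
  have hle := Nat.le_findGreatest (P := fun n => K n ≤ a) ((hK.id_le _).trans h) h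
  exact Nat.not_succ_le_self _ hle

/-- Finite partial sums of a nonnegative function over elements satisfying `p` are bounded by
its sum over the subtype. -/
lemma Summable.sum_le_tsum_subtype {α : Type*} {p : α → Prop} {g : α → ℝ} (hg : ∀ x, 0 ≤ g x)
    (h : Summable fun x : {x // p x} => g x) (s : Finset α) (hs : ∀ x ∈ s, p x) :
    ∑ x ∈ s, g x ≤ ∑' x : {x // p x}, g x := by
  classical
  rw [← Finset.sum_subtype_of_mem g hs]
  exact h.sum_le_tsum _ fun x _ => hg x

/-- If `f` is bounded by `B i` on finite subsets of each fibre of `N`, and `B` is summable,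
then `f` is summable with sum at most `∑' i, B i`. -/
lemma summable_and_tsum_le_of_fiberwise {α ι : Type*} {f : α → ℝ} {B : ι → ℝ} (N : α → ι)
    (hf : ∀ x, 0 ≤ f x) (hB₀ : ∀ i, 0 ≤ B i) (hB : Summable B)
    (h : ∀ (i : ι) (s : Finset α), (∀ x ∈ s, N x = i) → ∑ x ∈ s, f x ≤ B i) :
    Summable f ∧ ∑' x, f x ≤ ∑' i, B i := by
  classical
  have key : ∀ s : Finset α, ∑ x ∈ s, f x ≤ ∑' i, B i := fun s =>
    calc ∑ x ∈ s, f x = ∑ i ∈ s.image N, ∑ x ∈ s with N x = i, f x :=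
          (Finset.sum_fiberwise_of_maps_to (fun x hx => Finset.mem_image_of_mem N hx) f).symm
      _ ≤ ∑ i ∈ s.image N, B i :=
          Finset.sum_le_sum fun i _ => h i _ fun x hx => (Finset.mem_filter.1 hx).2
      _ ≤ ∑' i, B i := hB.sum_le_tsum _ fun i _ => hB₀ i
  exact ⟨summable_of_sum_le hf key, Real.tsum_le_of_sum_le hf key⟩

theorem stmt_9 (d : ℤ → ℝ) (u : ℕ → ℝ) (D : ℝ) (hD : 0 ≤ D) (c : ℤ → ℝ)
    (m : ℕ) (hm : 1 ≤ m) (K : ℕ → ℕ) (hK : StrictMono K)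
    (h₁ : ∀ j : ℤ, j ≠ 0 → |d j - 2 * u j.natAbs| ≤ D)
    (h₂ : ∀ n : ℕ, m ≤ n → ∀ j : ℤ, j ≠ 0 → K n ≤ j.natAbs → j.natAbs < K (n + 1) →
      c j ≤ -(1 / (n : ℝ)) * d j)
    (h₃ : ∀ n : ℕ, m ≤ n →
      Summable (fun j : {j : ℤ // K n ≤ j.natAbs} =>
        Real.exp (-(1 + 2 / (n : ℝ)) * u j.val.natAbs)) ∧
      Real.exp ((1 / 2 + 1 / (n : ℝ)) * D) *
        ∑' j : {j : ℤ // K n ≤ j.natAbs}, Real.exp (-(1 + 2 / (n : ℝ)) * u j.val.natAbs)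
        ≤ 1 / (n : ℝ) ^ 2) :
    Summable (fun j : {j : ℤ // K m ≤ j.natAbs} => Real.exp (c j - (1 / 2) * d j)) ∧
    ∑' j : {j : ℤ // K m ≤ j.natAbs}, Real.exp (c j - (1 / 2) * d j)
      ≤ ∑' n : {n : ℕ // m ≤ n}, 1 / (n : ℝ) ^ 2 := by
  choose N hmN hKN hNK using fun j : {j : ℤ // K m ≤ j.natAbs} => hK.exists_block j.2
  have hB : Summable fun n : {n : ℕ // m ≤ n} => 1 / ((n : ℕ) : ℝ) ^ 2 :=
    (Real.summable_one_div_nat_pow.2 one_lt_two).subtype {n | m ≤ n}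
  refine summable_and_tsum_le_of_fiberwise (fun j => ⟨N j, hmN j⟩)
    (fun _ => (Real.exp_pos _).le) (fun _ => by positivity) hB ?_
  rintro ⟨n, hn⟩ s hs
  obtain ⟨hsum, hle⟩ := h₃ n hn
  have hsN : ∀ j ∈ s, N j = n := fun j hj => congrArg Subtype.val (hs j hj)
  refine le_trans ?_ hle
  have hterm : ∀ j ∈ s, Real.exp (c j - (1 / 2) * d j) ≤
      Real.exp ((1 / 2 + 1 / (n : ℝ)) * D) *
        Real.exp (-(1 + 2 / (n : ℝ)) * u j.val.natAbs) := by
    intro j hj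
    have hj₀ : j.val ≠ 0 := by
      have h₁m : m ≤ K m := hK.id_le m
      have := j.2
      omega
    have hc := h₂ n hn j hj₀ (hsN j hj ▸ hKN j) (hsN j hj ▸ hNK j)
    have hd : 2 * u j.val.natAbs - D ≤ d j := by linarith [(abs_le.1 (h₁ j hj₀)).1]
    have hmul := mul_le_mul_of_nonneg_left hd (show (0 : ℝ) ≤ 1 / 2 + 1 / n by positivity)
    rw [← Real.exp_add, Real.exp_le_exp]
    rw [show (2 : ℝ) / n = 2 * (1 / n) by ring]
    linarith
  refine (Finset.sum_le_sum hterm).trans ?_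
  rw [← Finset.mul_sum]
  refine mul_le_mul_of_nonneg_left ?_ (Real.exp_pos _).le
  have hmap := Summable.sum_le_tsum_subtype
    (g := fun j : ℤ => Real.exp (-(1 + 2 / (n : ℝ)) * u j.natAbs))
    (fun _ => (Real.exp_pos _).le) hsum (s.map (Function.Embedding.subtype _)) (by
      intro x hx
      obtain ⟨j, hj, rfl⟩ := Finset.mem_map.1 hx
      exact hsN j hj ▸ hKN j)
  rwa [Finset.sum_map] at hmap
end
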